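/- arXiv:2101.12403 — 2 statements merged into one kernel-verified Lean document; each statement's English description precedes it below -/
import Mathlib

section
/- Suppose each C_i satisfies the (ε,δ)-lower deviation inequality and R ≥ (1−ε)Z. Then the mean-weighted allocation v = (R·μ_1/Z, …, R·μ_K/Z) has fairness Q(v) ≤ 1 − (1−ε)(1−δ) = ε + δ − εδ. -/
open MeasureTheory ProbabilityTheory

/-- Markov's inequality for the truncation `min X v`, at a level `a ≤ v`. -/
theorem mul_one_sub_le_integral_min {Ω : Type*} [MeasurableSpace Ω] {P : Measure Ω}
    [IsProbabilityMeasure P] {X : Ω → ℝ} (hmeas : Measurable X) (hint : Integrable X P)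
    (hnonneg : ∀ ω, 0 ≤ X ω) {a v δ : ℝ} (ha : 0 ≤ a) (hav : a ≤ v)
    (hδ : P.real {ω | X ω ≤ a} ≤ δ) :
    a * (1 - δ) ≤ ∫ ω, min (X ω) v ∂P := by
  have hmarkov : a * P.real {ω | a ≤ min (X ω) v} ≤ ∫ ω, min (X ω) v ∂P :=
    mul_meas_ge_le_integral_of_nonneg
      (Filter.Eventually.of_forall fun ω => le_min (hnonneg ω) (ha.trans hav))
      (hint.inf (integrable_const v)) a
  have hsub : {ω | X ω ≤ a}ᶜ ⊆ {ω | a ≤ min (X ω) v} := fun ω hω =>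
    le_min (lt_of_not_ge (show ¬ X ω ≤ a from hω)).le hav
  have hcompl := probReal_compl_eq_one_sub (μ := P) (measurableSet_le hmeas measurable_const :
    MeasurableSet {ω | X ω ≤ a})
  have hmono := measureReal_mono hsub (measure_ne_top P _)
  exact (mul_le_mul_of_nonneg_left (by linarith) ha).trans hmarkov

theorem integral_min_le {Ω : Type*} [MeasurableSpace Ω] {P : Measure Ω} [IsFiniteMeasure P]
    {X : Ω → ℝ} (hint : Integrable X P) (v : ℝ) :
    ∫ ω, min (X ω) v ∂P ≤ ∫ ω, X ω ∂P :=
  integral_mono (hint.inf (integrable_const v)) hint fun _ => min_le_left _ _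

/-- If each `C i` satisfies the `(ε,δ)`-lower deviation inequality and
`R ≥ (1-ε) Z`, then the mean-weighted allocation has fairness
`Q(v) ≤ 1 - (1-ε)(1-δ) = ε + δ - ε δ`. -/
theorem meanWeighted_fairness_highR
    {Ω : Type*} [MeasureSpace Ω] [IsProbabilityMeasure (ℙ : Measure Ω)]
    {K : ℕ} (hK : 0 < K)
    (C : Fin K → Ω → ℝ)
    (hmeas : ∀ i, Measurable (C i))
    (hint : ∀ i, Integrable (C i))
    (hnonneg : ∀ i, ∀ ω, 0 ≤ C i ω)
    (μ : Fin K → ℝ) (hμ : ∀ i, μ i = ∫ ω, C i ω) (hμpos : ∀ i, 0 < μ i)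
    (ε δ : ℝ) (hε0 : 0 < ε) (hε1 : ε < 1) (hδ0 : 0 < δ) (hδ1 : δ < 1)
    (hLD : ∀ i, (ℙ {ω | C i ω ≤ (1 - ε) * μ i}).toReal ≤ δ)
    (R : ℝ) (hR : 0 < R)
    (Z : ℝ) (hZ : Z = ∑ i, μ i)
    (hRZ : (1 - ε) * Z ≤ R)
    (v : Fin K → ℝ) (hv : ∀ i, v i = R * μ i / Z) :
    ∀ i j, |(∫ ω, min (C i ω) (v i)) / μ i - (∫ ω, min (C j ω) (v j)) / μ j|
      ≤ ε + δ - ε * δ := by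
  have hZpos : 0 < Z := hZ ▸ Finset.sum_pos (fun i _ => hμpos i) ⟨⟨0, hK⟩, Finset.mem_univ _⟩
  have lower : ∀ i, (1 - ε) * (1 - δ) ≤ (∫ ω, min (C i ω) (v i)) / μ i := fun i => by
    have hvi : (1 - ε) * μ i ≤ v i := by
      rw [hv, le_div_iff₀ hZpos]
      nlinarith [hμpos i]
    have hmin := mul_one_sub_le_integral_min (hmeas i) (hint i) (hnonneg i)
      (mul_nonneg (sub_nonneg.mpr hε1.le) (hμpos i).le) hvi (hLD i)
    rw [le_div_iff₀ (hμpos i)]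
    linarith
  have upper : ∀ i, (∫ ω, min (C i ω) (v i)) / μ i ≤ 1 := fun i =>
    (div_le_one (hμpos i)).mpr ((integral_min_le (hint i) (v i)).trans (hμ i).ge)
  intro i j
  rw [abs_sub_le_iff]
  constructor <;> linarith [lower i, lower j, upper i, upper j]
end

section
/- Suppose each C_i satisfies the (ε,δ)-lower deviation inequality. Then for any R > 0, the mean-weighted allocation v = (R·μ_1/Z, …, R·μ_K/Z) has fairness Q(v) ≤ ε + δ − εδ. -/
open MeasureTheory ProbabilityTheory

/-- The truncated mean `E[min(X, t)]` is at most `min(E[X], t)`. -/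
theorem integral_min_const_le {Ω : Type*} [MeasurableSpace Ω] {P : Measure Ω}
    [IsProbabilityMeasure P] {X : Ω → ℝ} (hX : Integrable X P) (t : ℝ) :
    ∫ ω, min (X ω) t ∂P ≤ min (∫ ω, X ω ∂P) t := by
  have hmin : Integrable (fun ω => min (X ω) t) P := hX.inf (integrable_const t)
  refine le_min (integral_mono hmin hX fun ω => min_le_left _ _) ?_
  simpa using integral_mono hmin (integrable_const t) fun ω => min_le_right (X ω) t

/-- If a nonnegative variable `X` is at most `b` with probability at most `δ`, then
`E[min(X, t)] ≥ (1 - δ) min(b, t)`. -/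
theorem le_integral_min_const {Ω : Type*} [MeasurableSpace Ω] {P : Measure Ω}
    [IsProbabilityMeasure P] {X : Ω → ℝ} (hmeas : Measurable X) (hX : Integrable X P)
    (hX0 : ∀ ω, 0 ≤ X ω) {b t δ : ℝ} (hb : 0 ≤ b) (ht : 0 ≤ t)
    (hδ : P.real {ω | X ω ≤ b} ≤ δ) :
    (1 - δ) * min b t ≤ ∫ ω, min (X ω) t ∂P := by
  have hS : MeasurableSet {ω | X ω ≤ b} := measurableSet_le hmeas measurable_const
  have hmin : Integrable (fun ω => min (X ω) t) P := hX.inf (integrable_const t)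
  calc (1 - δ) * min b t ≤ P.real {ω | X ω ≤ b}ᶜ * min b t := by
        rw [probReal_compl_eq_one_sub hS]
        gcongr
    _ = ∫ ω, {ω | X ω ≤ b}ᶜ.indicator (fun _ => min b t) ω ∂P := by
        rw [integral_indicator_const _ hS.compl, smul_eq_mul]
    _ ≤ ∫ ω, min (X ω) t ∂P := by
        refine integral_mono ((integrable_const _).indicator hS.compl) hmin fun ω => ?_
        refine Set.indicator_apply_le' (fun hω => ?_) fun _ => le_min (hX0 ω) ht
        exact min_le_min_right t (not_le.mp (Set.notMem_ofPred_iff.mp hω)).le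

/-- If each `C i` satisfies the `(ε,δ)`-lower deviation inequality, then for any
total resource `R > 0` the mean-weighted allocation has fairness `Q(v) ≤ ε + δ - ε δ`. -/
theorem meanWeighted_fairness
    {Ω : Type*} [MeasureSpace Ω] [IsProbabilityMeasure (ℙ : Measure Ω)]
    {K : ℕ} (hK : 0 < K)
    (C : Fin K → Ω → ℝ)
    (hmeas : ∀ i, Measurable (C i))
    (hint : ∀ i, Integrable (C i))
    (hnonneg : ∀ i, ∀ ω, 0 ≤ C i ω)
    (μ : Fin K → ℝ) (hμ : ∀ i, μ i = ∫ ω, C i ω) (hμpos : ∀ i, 0 < μ i)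
    (ε δ : ℝ) (hε0 : 0 < ε) (hε1 : ε < 1) (hδ0 : 0 < δ) (hδ1 : δ < 1)
    (hLD : ∀ i, (ℙ {ω | C i ω ≤ (1 - ε) * μ i}).toReal ≤ δ)
    (R : ℝ) (hR : 0 < R)
    (Z : ℝ) (hZ : Z = ∑ i, μ i)
    (v : Fin K → ℝ) (hv : ∀ i, v i = R * μ i / Z) :
    ∀ i j, |(∫ ω, min (C i ω) (v i)) / μ i - (∫ ω, min (C j ω) (v j)) / μ j|
      ≤ ε + δ - ε * δ := by
  have hZ0 : 0 < Z := hZ ▸ Finset.sum_pos (fun i _ => hμpos i) ⟨⟨0, hK⟩, Finset.mem_univ _⟩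
  obtain ⟨t, ht⟩ : ∃ t, t = R / Z := ⟨_, rfl⟩
  have ht0 : 0 < t := ht ▸ div_pos hR hZ0
  have hvt : ∀ i, v i = t * μ i := fun i => by rw [hv, ht]; ring
  have hm0 : 0 ≤ min 1 t := le_min zero_le_one ht0.le
  have hm1 : min 1 t ≤ 1 := min_le_left _ _
  have upper : ∀ i, (∫ ω, min (C i ω) (v i)) / μ i ≤ min 1 t := fun i => by
    rw [div_le_iff₀ (hμpos i), min_mul_of_nonneg _ _ (hμpos i).le, one_mul, ← hvt]
    simpa only [← hμ i] using integral_min_const_le (hint i) (v i)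
  have lower : ∀ i, (1 - δ) * ((1 - ε) * min 1 t) ≤ (∫ ω, min (C i ω) (v i)) / μ i := fun i => by
    have hmin : (1 - ε) * min 1 t ≤ min (1 - ε) t := by
      refine le_min (mul_le_of_le_one_right (by linarith) hm1) ?_
      exact (mul_le_of_le_one_left hm0 (by linarith)).trans (min_le_right _ _)
    refine (mul_le_mul_of_nonneg_left hmin (by linarith)).trans ?_
    rw [le_div_iff₀ (hμpos i), mul_assoc, min_mul_of_nonneg _ _ (hμpos i).le, ← hvt]
    refine le_integral_min_const (hmeas i) (hint i) (hnonneg i) ?_ ?_ (hLD i)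
    · exact mul_nonneg (by linarith) (hμpos i).le
    · exact hvt i ▸ mul_nonneg ht0.le (hμpos i).le
  have gap : min 1 t - (1 - δ) * ((1 - ε) * min 1 t) ≤ ε + δ - ε * δ := by
    have hc : 0 ≤ ε + δ - ε * δ := by nlinarith
    calc min 1 t - (1 - δ) * ((1 - ε) * min 1 t) = (ε + δ - ε * δ) * min 1 t := by ring
      _ ≤ ε + δ - ε * δ := mul_le_of_le_one_right hc hm1
  intro i j
  rw [abs_sub_le_iff]
  constructor <;> linarith [upper i, upper j, lower i, lower j]
end
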